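/- Let W be a finite nonempty subset of ℝ² and let a_1, a_2 : W → ℝ be coefficient maps defining two tropical polynomials f_1, f_2, both with the same support W. Then the set of nondegenerate solutions of the tropical system f_1, f_2 is finite, and twice its cardinality is at most (|W| − 1)(|W| − 2). -/

import Mathlib

open scoped Pointwise

/-- The tropical polynomial with support `W ⊂ ℝ²` and coefficient map `a`:
`f(x) = max_{w ∈ W} (a w + ⟨w, x⟩)`. -/
noncomputable def tropVal (W : Finset (Fin 2 → ℝ)) (hW : W.Nonempty)
    (a : (Fin 2 → ℝ) → ℝ) (x : Fin 2 → ℝ) : ℝ :=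
  W.sup' hW fun w => a w + ∑ j, w j * x j

/-- The set of maximizers `S(x) = {w ∈ W : a w + ⟨w, x⟩ = f(x)}`. -/
noncomputable def tropArgmax (W : Finset (Fin 2 → ℝ)) (hW : W.Nonempty)
    (a : (Fin 2 → ℝ) → ℝ) (x : Fin 2 → ℝ) : Finset (Fin 2 → ℝ) :=
  W.filter fun w => a w + ∑ j, w j * x j = tropVal W hW a x

/-- `x` is a nondegenerate solution of the tropical system given by two tropical
polynomials with common support `W ⊂ ℝ²` and coefficient maps `a 1, a 2`. -/
noncomputable def IsNondegTropSol₂ (W : Finset (Fin 2 → ℝ)) (hW : W.Nonempty)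
    (a : Fin 2 → (Fin 2 → ℝ) → ℝ) (x : Fin 2 → ℝ) : Prop :=
  (∀ i : Fin 2, Module.finrank ℝ
      (vectorSpan ℝ ((tropArgmax W hW (a i) x : Set (Fin 2 → ℝ)))) = 1) ∧
  (⨆ i : Fin 2, vectorSpan ℝ ((tropArgmax W hW (a i) x : Set (Fin 2 → ℝ)))) = ⊤

open Filter Topology Matrix

/-- `q` is a subgradient of `g` at `y`. -/
def IsSubgradient (g : (Fin 2 → ℝ) → ℝ) (q y : Fin 2 → ℝ) : Prop :=
  ∀ x, g y + q ⬝ᵥ (x - y) ≤ g x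

lemma IsSubgradient.add {g h : (Fin 2 → ℝ) → ℝ} {p q y : Fin 2 → ℝ}
    (hg : IsSubgradient g p y) (hh : IsSubgradient h q y) :
    IsSubgradient (fun x => g x + h x) (p + q) y := by
  intro x
  have h1 := hg x
  have h2 := hh x
  simp only [add_dotProduct]
  linarith

lemma dotProduct_self_eq_zero_fin_two {v : Fin 2 → ℝ} (h : v ⬝ᵥ v ≤ 0) : v = 0 :=
  dotProduct_self_eq_zero.1 (le_antisymm h (by
    simp only [dotProduct, Fin.sum_univ_two]; nlinarith [sq_nonneg (v 0), sq_nonneg (v 1)]))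

lemma IsSubgradient.unique {g : (Fin 2 → ℝ) → ℝ} {p c y z : Fin 2 → ℝ} {ε : ℝ} (hε : 0 < ε)
    (hy : IsSubgradient g (p + ε • (c - y)) y) (hz : IsSubgradient g (p + ε • (c - z)) z) :
    y = z := by
  have h1 := hy z
  have h2 := hz y
  have h3 : ε * ((y - z) ⬝ᵥ (y - z)) ≤ 0 := by
    simp only [dotProduct, Fin.sum_univ_two, Pi.add_apply, Pi.sub_apply, Pi.smul_apply,
      smul_eq_mul] at *
    nlinarith
  exact sub_eq_zero.1 (dotProduct_self_eq_zero_fin_two (nonpos_of_mul_nonpos_right h3 hε))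

/-- A point avoiding finitely many lines. -/
lemma exists_forall_dotProduct_ne {ι : Type*} (F : Finset ι) (n : ι → Fin 2 → ℝ) (b : ι → ℝ) :
    ∃ c : Fin 2 → ℝ, ∀ i ∈ F, n i ≠ 0 → n i ⬝ᵥ c ≠ b i := by
  classical
  let P : ι → Polynomial ℝ := fun i =>
    Polynomial.C (n i 1) * Polynomial.X ^ 2 + Polynomial.C (n i 0) * Polynomial.X
      + Polynomial.C (- b i)
  have hP : ∀ i, n i ≠ 0 → P i ≠ 0 := by
    intro i hi h0
    apply hi
    have h1 : (P i).coeff 1 = 0 := by rw [h0]; simp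
    have h2 : (P i).coeff 2 = 0 := by rw [h0]; simp
    simp only [P, Polynomial.coeff_add, Polynomial.coeff_C_mul, Polynomial.coeff_X_pow,
      Polynomial.coeff_X, Polynomial.coeff_C] at h1 h2
    ext j
    fin_cases j
    · simpa using h1
    · simpa using h2
  obtain ⟨t, ht⟩ := Infinite.exists_notMem_finset (F.biUnion fun i => (P i).roots.toFinset)
  refine ⟨![t, t ^ 2], fun i hi hn he => ht ?_⟩
  rw [Finset.mem_biUnion]
  refine ⟨i, hi, ?_⟩
  rw [Multiset.mem_toFinset, Polynomial.mem_roots (hP i hn)]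
  simp only [dotProduct, Fin.sum_univ_two, Matrix.cons_val_zero, Matrix.cons_val_one] at he
  simp only [P, Polynomial.IsRoot, Polynomial.eval_add, Polynomial.eval_mul, Polynomial.eval_C,
    Polynomial.eval_pow, Polynomial.eval_X]
  linarith

section TropicalPolynomial

variable {W : Finset (Fin 2 → ℝ)} {hW : W.Nonempty} {a : (Fin 2 → ℝ) → ℝ}

lemma le_tropVal {w : Fin 2 → ℝ} (hw : w ∈ W) (x : Fin 2 → ℝ) :
    a w + w ⬝ᵥ x ≤ tropVal W hW a x :=
  Finset.le_sup' (fun w => a w + ∑ j, w j * x j) hw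

lemma mem_tropArgmax {w x : Fin 2 → ℝ} :
    w ∈ tropArgmax W hW a x ↔ w ∈ W ∧ a w + w ⬝ᵥ x = tropVal W hW a x := by
  simp [tropArgmax, dotProduct]

lemma tropVal_le_iff {x : Fin 2 → ℝ} {r : ℝ} :
    tropVal W hW a x ≤ r ↔ ∀ w ∈ W, a w + w ⬝ᵥ x ≤ r := by
  simp [tropVal, dotProduct]

lemma tropVal_lt_iff {x : Fin 2 → ℝ} {r : ℝ} :
    tropVal W hW a x < r ↔ ∀ w ∈ W, a w + w ⬝ᵥ x < r := by
  simp [tropVal, dotProduct]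

lemma tropArgmax_nonempty (x : Fin 2 → ℝ) : (tropArgmax W hW a x).Nonempty := by
  obtain ⟨w, hw, h⟩ := Finset.exists_mem_eq_sup' hW fun w => a w + ∑ j, w j * x j
  exact ⟨w, mem_tropArgmax.2 ⟨hw, h.symm⟩⟩

lemma isSubgradient_of_mem_tropArgmax {w y : Fin 2 → ℝ} (hw : w ∈ tropArgmax W hW a y) :
    IsSubgradient (tropVal W hW a) w y := by
  intro x
  rw [mem_tropArgmax] at hw
  have := le_tropVal (hW := hW) (a := a) hw.1 x
  rw [dotProduct_sub]
  linarith

lemma isSubgradient_segment {u v y : Fin 2 → ℝ} (hu : u ∈ tropArgmax W hW a y)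
    (hv : v ∈ tropArgmax W hW a y) {t : ℝ} (h0 : 0 ≤ t) (h1 : t ≤ 1) :
    IsSubgradient (tropVal W hW a) (u + t • (v - u)) y := by
  intro x
  have h2 := isSubgradient_of_mem_tropArgmax hu x
  have h3 := isSubgradient_of_mem_tropArgmax hv x
  rw [add_dotProduct, smul_dotProduct, sub_dotProduct, smul_eq_mul]
  nlinarith

lemma continuous_tropVal : Continuous (tropVal W hW a) := by
  unfold tropVal
  refine Continuous.finset_sup'_apply hW fun w _ => ?_
  fun_prop

lemma tropVal_segment_le (x y : Fin 2 → ℝ) {t : ℝ} (h0 : 0 ≤ t) (h1 : t ≤ 1) :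
    tropVal W hW a (y + t • (x - y)) ≤
      tropVal W hW a y + t * (tropVal W hW a x - tropVal W hW a y) := by
  rw [tropVal_le_iff]
  intro w hw
  have h2 := le_tropVal (hW := hW) (a := a) hw x
  have h3 := le_tropVal (hW := hW) (a := a) hw y
  rw [dotProduct_add, dotProduct_smul, dotProduct_sub, smul_eq_mul]
  nlinarith

/-- In each direction, a subgradient is dominated by some maximizer. -/
lemma IsSubgradient.exists_le {q y : Fin 2 → ℝ} (h : IsSubgradient (tropVal W hW a) q y)
    (e : Fin 2 → ℝ) : ∃ u ∈ tropArgmax W hW a y, q ⬝ᵥ e ≤ u ⬝ᵥ e := by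
  by_contra! hcon
  have key : ∀ w ∈ W, ∀ᶠ t in 𝓝[>] (0 : ℝ),
      a w + w ⬝ᵥ (y + t • e) < tropVal W hW a y + q ⬝ᵥ (t • e) := by
    intro w hw
    by_cases hS : w ∈ tropArgmax W hW a y
    · filter_upwards [self_mem_nhdsWithin] with t ht
      have h1 := mul_lt_mul_of_pos_left (hcon w hS) (Set.mem_Ioi.1 ht)
      have h2 := (mem_tropArgmax.1 hS).2
      simp only [dotProduct_add, dotProduct_smul, smul_eq_mul]
      linarith
    · have h1 : a w + w ⬝ᵥ y < tropVal W hW a y :=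
        lt_of_le_of_ne (le_tropVal hw y) fun h2 => hS (mem_tropArgmax.2 ⟨hw, h2⟩)
      apply Filter.Eventually.filter_mono nhdsWithin_le_nhds
      have h2 : ContinuousAt (fun t : ℝ => a w + w ⬝ᵥ (y + t • e)) 0 := by
        simp only [dotProduct_add, dotProduct_smul, smul_eq_mul]; fun_prop
      have h3 : ContinuousAt (fun t : ℝ => tropVal W hW a y + q ⬝ᵥ (t • e)) 0 := by
        simp only [dotProduct_smul, smul_eq_mul]; fun_prop
      exact h2.eventually_lt h3 (by simpa using h1)
  obtain ⟨t, ht⟩ := ((Finset.eventually_all W).2 key).exists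
  have h1 := h (y + t • e)
  rw [add_sub_cancel_left] at h1
  exact absurd (tropVal_lt_iff.2 ht) (not_lt.2 h1)

/-- The proximal point of `f - ⟨w, ·⟩`. -/
lemma exists_isSubgradient {w : Fin 2 → ℝ} (hw : w ∈ W) (c : Fin 2 → ℝ) {ε : ℝ} (hε : 0 < ε) :
    ∃ y, IsSubgradient (tropVal W hW a) (w + ε • (c - y)) y := by
  set f := tropVal W hW a with hf
  let h : (Fin 2 → ℝ) → ℝ := fun x => f x - w ⬝ᵥ x + ε / 2 * ((x - c) ⬝ᵥ (x - c))
  have hcont : Continuous h := by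
    have := continuous_tropVal (W := W) (hW := hW) (a := a)
    simp only [h, dotProduct]
    fun_prop
  have hlim : Tendsto h (cocompact _) atTop := by
    have h1 : Tendsto (fun x : Fin 2 → ℝ => a w + ε / 2 * (dist x c) ^ 2) (cocompact _) atTop := by
      refine tendsto_atTop_add_const_left _ _ (Tendsto.const_mul_atTop (by positivity) ?_)
      exact (tendsto_pow_atTop two_ne_zero).comp (tendsto_dist_right_cocompact_atTop c)
    refine tendsto_atTop_mono (fun x => ?_) h1
    have h2 := le_tropVal (hW := hW) (a := a) hw x
    have h3 : dist x c ^ 2 ≤ (x - c) ⬝ᵥ (x - c) := by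
      have h5 : 0 ≤ (x - c) ⬝ᵥ (x - c) := by
        simp only [dotProduct, Fin.sum_univ_two]
        nlinarith [sq_nonneg ((x - c) 0), sq_nonneg ((x - c) 1)]
      have h4 : dist x c ≤ √((x - c) ⬝ᵥ (x - c)) := by
        rw [dist_pi_le_iff (Real.sqrt_nonneg _)]
        intro j
        rw [Real.dist_eq]
        apply Real.abs_le_sqrt
        simp only [dotProduct, Fin.sum_univ_two, Pi.sub_apply]
        fin_cases j
        · simp only [Fin.zero_eta]; nlinarith [sq_nonneg (x 1 - c 1)]
        · simp only [Fin.mk_one]; nlinarith [sq_nonneg (x 0 - c 0)]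
      calc dist x c ^ 2 ≤ √((x - c) ⬝ᵥ (x - c)) ^ 2 := by gcongr
        _ = _ := Real.sq_sqrt h5
    have h4 := mul_le_mul_of_nonneg_left h3 (show 0 ≤ ε / 2 by positivity)
    simp only [h]
    linarith
  obtain ⟨y, hy⟩ := hcont.exists_forall_le hlim
  refine ⟨y, fun x => ?_⟩
  have key : ∀ t ∈ Set.Ioo (0 : ℝ) 1,
      f y + (w + ε • (c - y)) ⬝ᵥ (x - y) ≤ f x + t * (ε / 2 * ((x - y) ⬝ᵥ (x - y))) := by
    intro t ht
    have h1 := hy (y + t • (x - y))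
    have h2 := tropVal_segment_le (hW := hW) (a := a) x y ht.1.le ht.2.le
    rw [← hf] at h2
    refine le_of_mul_le_mul_left ?_ ht.1
    simp only [h, dotProduct, Fin.sum_univ_two, Pi.add_apply, Pi.sub_apply, Pi.smul_apply,
      smul_eq_mul] at h1 ⊢
    linear_combination h1 + h2
  have hl : Tendsto (fun t : ℝ => f x + t * (ε / 2 * ((x - y) ⬝ᵥ (x - y)))) (𝓝[>] 0) (𝓝 (f x)) := by
    have : ContinuousAt (fun t : ℝ => f x + t * (ε / 2 * ((x - y) ⬝ᵥ (x - y)))) 0 := by fun_prop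
    simpa using this.tendsto.mono_left nhdsWithin_le_nhds
  exact ge_of_tendsto hl
    (Filter.mem_of_superset (Ioo_mem_nhdsGT one_pos) key)

lemma IsSubgradient.proximal_bound {w c y : Fin 2 → ℝ} {ε : ℝ} (hε : 0 < ε) (hw : w ∈ W)
    (h : IsSubgradient (tropVal W hW a) (w + ε • (c - y)) y) :
    (ε • (c - y)) ⬝ᵥ (ε • (c - y)) ≤ ε * (tropVal W hW a c - (a w + w ⬝ᵥ c)) := by
  have h1 := h c
  have h2 := le_tropVal (hW := hW) (a := a) hw y
  rw [add_dotProduct, dotProduct_sub w] at h1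
  rw [dotProduct_smul, smul_eq_mul]
  exact mul_le_mul_of_nonneg_left (by linarith) hε.le

end TropicalPolynomial

lemma exists_vectorSpan_eq_span_singleton {S : Set (Fin 2 → ℝ)}
    (h : Module.finrank ℝ (vectorSpan ℝ S) = 1) :
    ∃ u ∈ S, ∃ v ∈ S, v - u ≠ 0 ∧ vectorSpan ℝ S = Submodule.span ℝ {v - u} := by
  have hn : ¬ S.Subsingleton := by
    intro hs
    rw [vectorSpan_of_subsingleton ℝ hs, finrank_bot] at h
    exact zero_ne_one h
  rw [Set.not_subsingleton_iff] at hn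
  obtain ⟨u, hu, v, hv, huv⟩ := hn
  have hne : v - u ≠ 0 := sub_ne_zero.2 huv.symm
  refine ⟨u, hu, v, hv, hne, ?_⟩
  symm
  apply Submodule.eq_of_le_of_finrank_eq
  · rw [Submodule.span_singleton_le_iff_mem]
    exact vsub_mem_vectorSpan ℝ hv hu
  · rw [h, finrank_span_singleton hne]

lemma exists_normal {S : Set (Fin 2 → ℝ)} (h : Module.finrank ℝ (vectorSpan ℝ S) = 1) :
    ∃ (n : Fin 2 → ℝ) (b : ℝ), n ≠ 0 ∧ ∀ u ∈ S, u ⬝ᵥ n = b := by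
  obtain ⟨u, hu, v, -, hne, hs⟩ := exists_vectorSpan_eq_span_singleton h
  refine ⟨![(u - v) 1, (v - u) 0], u ⬝ᵥ ![(u - v) 1, (v - u) 0], fun h0 => hne ?_, ?_⟩
  · ext j
    have h1 := congrFun h0 0
    have h2 := congrFun h0 1
    fin_cases j
    · simpa using h2
    · simpa using (neg_eq_zero.2 h1)
  · intro s hsS
    have h1 : s - u ∈ vectorSpan ℝ S := vsub_mem_vectorSpan ℝ hsS hu
    rw [hs, Submodule.mem_span_singleton] at h1
    obtain ⟨r, hr⟩ := h1
    rw [← sub_eq_zero, ← sub_dotProduct, ← hr]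
    simp [dotProduct, Fin.sum_univ_two]
    ring

lemma eventually_isSubgradient_of_mem_span {W : Finset (Fin 2 → ℝ)} {hW : W.Nonempty}
    {a : (Fin 2 → ℝ) → ℝ} {u v y : Fin 2 → ℝ} (hu : u ∈ tropArgmax W hW a y)
    (hv : v ∈ tropArgmax W hW a y) (r : ℝ) :
    ∃ p ∈ W, ∀ᶠ ε in 𝓝[>] (0 : ℝ),
      IsSubgradient (tropVal W hW a) (p + ε • (r • (v - u))) y := by
  have hsmall : ∀ᶠ ε in 𝓝[>] (0 : ℝ), ε * |r| < 1 := by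
    apply Filter.Eventually.filter_mono nhdsWithin_le_nhds
    have h2 : ContinuousAt (fun t : ℝ => t * |r|) 0 := by fun_prop
    exact h2.eventually_lt continuousAt_const (by simp)
  rcases le_total 0 r with hr | hr
  · refine ⟨u, (mem_tropArgmax.1 hu).1, ?_⟩
    filter_upwards [hsmall, self_mem_nhdsWithin] with ε h1 h2
    rw [abs_of_nonneg hr] at h1
    rw [smul_smul]
    exact isSubgradient_segment hu hv (mul_nonneg (Set.mem_Ioi.1 h2).le hr) h1.le
  · refine ⟨v, (mem_tropArgmax.1 hv).1, ?_⟩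
    filter_upwards [hsmall, self_mem_nhdsWithin] with ε h1 h2
    rw [abs_of_nonpos hr] at h1
    have h3 := isSubgradient_segment hv hu
      (mul_nonneg (Set.mem_Ioi.1 h2).le (neg_nonneg.2 hr)) h1.le
    have h4 : ε • (r • (v - u)) = (ε * -r) • (u - v) := by module
    rwa [h4]

lemma IsNondegTropSol₂.exists_eventually_isSubgradient {W : Finset (Fin 2 → ℝ)} {hW : W.Nonempty}
    {a : Fin 2 → (Fin 2 → ℝ) → ℝ} {y : Fin 2 → ℝ} (h : IsNondegTropSol₂ W hW a y)
    (c : Fin 2 → ℝ) :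
    ∃ p ∈ W + W, ∀ᶠ ε in 𝓝[>] (0 : ℝ),
      IsSubgradient (fun x => tropVal W hW (a 0) x + tropVal W hW (a 1) x)
        (p + ε • (c - y)) y := by
  obtain ⟨u, hu, v, hv, -, hs⟩ := exists_vectorSpan_eq_span_singleton (h.1 0)
  obtain ⟨u', hu', v', hv', -, hs'⟩ := exists_vectorSpan_eq_span_singleton (h.1 1)
  have hmem : c - y ∈ Submodule.span ℝ {v - u} ⊔ Submodule.span ℝ {v' - u'} := by
    rw [← hs, ← hs']
    have h2 := h.2
    rw [eq_top_iff] at h2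
    refine (h2.trans (iSup_le fun i => ?_)) Submodule.mem_top
    fin_cases i
    · exact le_sup_left
    · exact le_sup_right
  obtain ⟨d, hd, d', hd', hdd⟩ := Submodule.mem_sup.1 hmem
  obtain ⟨r, rfl⟩ := Submodule.mem_span_singleton.1 hd
  obtain ⟨r', rfl⟩ := Submodule.mem_span_singleton.1 hd'
  obtain ⟨p, hp, hpe⟩ := eventually_isSubgradient_of_mem_span hu hv r
  obtain ⟨p', hp', hpe'⟩ := eventually_isSubgradient_of_mem_span hu' hv' r'
  refine ⟨p + p', Finset.add_mem_add hp hp', ?_⟩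
  filter_upwards [hpe, hpe'] with ε h1 h2
  have h3 := h1.add h2
  rwa [add_add_add_comm, ← smul_add, hdd] at h3

lemma eventually_ne_nhdsGT_zero (r : ℝ) : ∀ᶠ ε in 𝓝[>] (0 : ℝ), ε ≠ r := by
  rcases le_or_gt r 0 with hr | hr
  · filter_upwards [self_mem_nhdsWithin] with ε h
    exact (hr.trans_lt h).ne'
  · filter_upwards [Ioo_mem_nhdsGT hr] with ε h
    exact h.2.ne

lemma two_mul_card_add_self_le (W : Finset (Fin 2 → ℝ)) :
    2 * (W + W).card ≤ W.card * (W.card + 1) := by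
  classical
  have hsub : W + W ⊆ W.sym2.image (Sym2.lift ⟨fun x y => x + y, add_comm⟩) := by
    intro p hp
    obtain ⟨x, hx, y, hy, rfl⟩ := Finset.mem_add.1 hp
    exact Finset.mem_image.2 ⟨s(x, y), Finset.mk_mem_sym2_iff.2 ⟨hx, hy⟩, rfl⟩
  have h1 := (Finset.card_le_card hsub).trans Finset.card_image_le
  rw [Finset.card_sym2] at h1
  have h3 : (W.card + 1).choose 2 * 2 = W.card * (W.card + 1) := by
    rw [Nat.choose_two_right, Nat.div_mul_cancel (Nat.even_mul_pred_self _).two_dvd]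
    simp [mul_comm]
  omega

lemma card_add_two_mul_card_le (W : Finset (Fin 2 → ℝ)) (hW : W.Nonempty)
    (a : Fin 2 → (Fin 2 → ℝ) → ℝ) (T : Finset (Fin 2 → ℝ))
    (hT : ∀ y ∈ T, IsNondegTropSol₂ W hW a y) :
    T.card + 2 * W.card ≤ (W + W).card + 1 := by
  classical
  let f : Fin 2 → (Fin 2 → ℝ) → ℝ := fun i => tropVal W hW (a i)
  let g : (Fin 2 → ℝ) → ℝ := fun x => f 0 x + f 1 x
  have hnorm : ∀ (i : Fin 2) (y : Fin 2 → ℝ), ∃ (n : Fin 2 → ℝ) (b : ℝ), y ∈ T →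
      n ≠ 0 ∧ ∀ u ∈ tropArgmax W hW (a i) y, u ⬝ᵥ n = b := by
    intro i y
    by_cases hy : y ∈ T
    · obtain ⟨n, b, h⟩ := exists_normal ((hT y hy).1 i)
      exact ⟨n, b, fun _ => h⟩
    · exact ⟨0, 0, fun h => absurd h hy⟩
  choose n b hnb using hnorm
  obtain ⟨c, hc⟩ := exists_forall_dotProduct_ne ((Finset.univ : Finset (Fin 2)) ×ˢ T)
    (fun z => n z.1 z.2) (fun z => n z.1 z.2 ⬝ᵥ z.2)
  have hc' : ∀ i, ∀ y ∈ T, (c - y) ⬝ᵥ n i y ≠ 0 := by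
    intro i y hy h0
    refine hc (i, y) (by simp [hy]) (hnb i y hy).1 ?_
    rw [dotProduct_comm, dotProduct_sub] at h0
    exact sub_eq_zero.1 h0
  have hP : ∀ y, ∃ p, y ∈ T → p ∈ W + W ∧
      ∀ᶠ ε in 𝓝[>] (0 : ℝ), IsSubgradient g (p + ε • (c - y)) y := by
    intro y
    by_cases hy : y ∈ T
    · obtain ⟨p, h⟩ := (hT y hy).exists_eventually_isSubgradient c
      exact ⟨p, fun _ => h⟩
    · exact ⟨0, fun h => absurd h hy⟩
  choose P hP using hP
  have hE1 : ∀ᶠ ε in 𝓝[>] (0 : ℝ), ∀ y ∈ T, IsSubgradient g (P y + ε • (c - y)) y :=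
    (Finset.eventually_all T).2 fun y hy => (hP y hy).2
  have hE2 : ∀ᶠ ε in 𝓝[>] (0 : ℝ), ∀ i, ∀ y ∈ T, ∀ w ∈ W,
      (w + ε • (c - y)) ⬝ᵥ n i y ≠ b i y := by
    refine eventually_all.2 fun i => (Finset.eventually_all T).2 fun y hy =>
      (Finset.eventually_all W).2 fun w _ => ?_
    filter_upwards [eventually_ne_nhdsGT_zero ((b i y - w ⬝ᵥ n i y) / ((c - y) ⬝ᵥ n i y))]
      with ε hε h0
    apply hε
    rw [eq_div_iff (hc' i y hy), ← h0, add_dotProduct, smul_dotProduct, smul_eq_mul]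
    ring
  have hE3 : ∀ᶠ ε in 𝓝[>] (0 : ℝ), ∀ i, ∀ w ∈ W, ∀ u ∈ W, ∀ v ∈ W, u ≠ v →
      ε * (f i c - (a i w + w ⬝ᵥ c)) < (u - v) ⬝ᵥ (u - v) := by
    refine eventually_all.2 fun i => (Finset.eventually_all W).2 fun w _ =>
      (Finset.eventually_all W).2 fun u _ => (Finset.eventually_all W).2 fun v _ =>
      eventually_imp_distrib_left.2 fun huv => ?_
    apply Filter.Eventually.filter_mono nhdsWithin_le_nhds
    have h2 : ContinuousAt (fun t : ℝ => t * (f i c - (a i w + w ⬝ᵥ c))) 0 := by fun_prop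
    refine h2.eventually_lt continuousAt_const ?_
    rw [zero_mul]
    by_contra h0
    exact huv (sub_eq_zero.1 (dotProduct_self_eq_zero_fin_two (not_lt.1 h0)))
  obtain ⟨ε, hε1, hε2, hε3, hε⟩ :=
    (hE1.and (hE2.and (hE3.and self_mem_nhdsWithin))).exists
  replace hε : 0 < ε := hε
  have hY : ∀ (i : Fin 2) (w : Fin 2 → ℝ), ∃ y, w ∈ W →
      IsSubgradient (f i) (w + ε • (c - y)) y := by
    intro i w
    by_cases hw : w ∈ W
    · obtain ⟨y, hy⟩ := exists_isSubgradient (hW := hW) (a := a i) hw c hε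
      exact ⟨y, fun _ => hy⟩
    · exact ⟨0, fun h => absurd h hw⟩
  choose Y hY using hY
  have hYT : ∀ i, ∀ w ∈ W, Y i w ∉ T := by
    intro i w hw hy
    obtain ⟨u, hu, hue⟩ := (hY i w hw).exists_le (n i (Y i w))
    obtain ⟨v, hv, hve⟩ := (hY i w hw).exists_le (-n i (Y i w))
    rw [(hnb i _ hy).2 u hu] at hue
    rw [dotProduct_neg, dotProduct_neg, (hnb i _ hy).2 v hv, neg_le_neg_iff] at hve
    exact hε2 i _ hy w hw (le_antisymm hue hve)
  obtain ⟨e, he⟩ := exists_forall_dotProduct_ne (W ×ˢ (Finset.univ : Finset (Fin 2)) ×ˢ W ×ˢ W)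
    (fun z => z.1 + ε • (c - Y z.2.1 z.2.2.1) - z.2.2.2) (fun _ => 0)
  have hM : ∀ y, ∃ u ∈ tropArgmax W hW (a 0) y, ∀ v ∈ tropArgmax W hW (a 0) y,
      v ⬝ᵥ e ≤ u ⬝ᵥ e := fun y => Finset.exists_max_image _ _ (tropArgmax_nonempty y)
  have hm : ∀ y, ∃ u ∈ tropArgmax W hW (a 1) y, ∀ v ∈ tropArgmax W hW (a 1) y,
      u ⬝ᵥ e ≤ v ⬝ᵥ e := fun y => Finset.exists_min_image _ _ (tropArgmax_nonempty y)
  choose M hMS hMle using hM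
  choose m hmS hmle using hm
  have hA : ∀ w ∈ W, IsSubgradient g ((w + m (Y 0 w)) + ε • (c - Y 0 w)) (Y 0 w) := by
    intro w hw
    have := (hY 0 w hw).add (isSubgradient_of_mem_tropArgmax (hmS (Y 0 w)))
    rwa [add_right_comm] at this
  have hB : ∀ w ∈ W, IsSubgradient g ((M (Y 1 w) + w) + ε • (c - Y 1 w)) (Y 1 w) := by
    intro w hw
    have := (isSubgradient_of_mem_tropArgmax (hMS (Y 1 w))).add (hY 1 w hw)
    rwa [← add_assoc] at this
  have hMW : ∀ y, M y ∈ W := fun y => (mem_tropArgmax.1 (hMS y)).1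
  have hmW : ∀ y, m y ∈ W := fun y => (mem_tropArgmax.1 (hmS y)).1
  have hinjT : Set.InjOn P T := by
    intro x hx y hy hxy
    have h1 := hε1 x hx
    rw [hxy] at h1
    exact h1.unique hε (hε1 y hy)
  have hinjA : Set.InjOn (fun w => w + m (Y 0 w)) W := by
    intro w hw v hv hwv
    simp only at hwv
    have h1 := hA w hw
    rw [hwv] at h1
    rw [h1.unique hε (hA v hv)] at hwv
    exact add_right_cancel hwv
  have hinjB : Set.InjOn (fun w => M (Y 1 w) + w) W := by
    intro w hw v hv hwv
    simp only at hwv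
    have h1 := hB w hw
    rw [hwv] at h1
    rw [h1.unique hε (hB v hv)] at hwv
    exact add_left_cancel hwv
  have hAB : W.image (fun w => w + m (Y 0 w)) ∩ W.image (fun w => M (Y 1 w) + w)
      ⊆ {M c + m c} := by
    intro p hp
    rw [Finset.mem_inter, Finset.mem_image, Finset.mem_image] at hp
    obtain ⟨⟨w, hw, rfl⟩, v, hv, hvw⟩ := hp
    have h1 := hA w hw
    rw [← hvw] at h1
    have hy : Y 0 w = Y 1 v := h1.unique hε (hB v hv)
    set y := Y 0 w with hy_def
    rw [← hy] at hvw
    obtain ⟨u, hu, hue⟩ := (hY 0 w hw).exists_le e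
    obtain ⟨u', hu', hue'⟩ := (hY 1 v hv).exists_le (-e)
    rw [dotProduct_neg, dotProduct_neg, neg_le_neg_iff, ← hy] at hue'
    rw [← hy] at hu'
    rw [← hy_def] at hue
    have h2 : (w + ε • (c - y) - M y) ⬝ᵥ e = 0 := by
      have h3 := hMle y u hu
      have h4 := hmle y u' hu'
      have h5 := congrArg (· ⬝ᵥ e) hvw
      simp only [sub_dotProduct, add_dotProduct] at *
      linarith
    have h3 : w + ε • (c - y) - M y = 0 := by
      by_contra h0
      exact he (w, 0, w, M y) (by simp [hw, hMW]) h0 h2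
    have h4 : ε • (c - y) = M y - w := by
      rw [← sub_eq_zero, ← h3]; abel
    have h5 : M y = w := by
      by_contra h0
      have h6 := hε3 0 w hw (M y) (hMW y) w hw h0
      have h7 := (hY 0 w hw).proximal_bound hε hw
      rw [← hy_def, h4] at h7
      exact absurd h6 (not_lt.2 h7)
    rw [h5, sub_self, smul_eq_zero_iff_right hε.ne', sub_eq_zero] at h4
    rw [Finset.mem_singleton, h4, h5]
  have hdisj : Disjoint (T.image P)
      (W.image (fun w => w + m (Y 0 w)) ∪ W.image (fun w => M (Y 1 w) + w)) := by
    rw [Finset.disjoint_left]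
    intro p hp hp'
    obtain ⟨y, hy, rfl⟩ := Finset.mem_image.1 hp
    rcases Finset.mem_union.1 hp' with h | h
    · obtain ⟨w, hw, hwp⟩ := Finset.mem_image.1 h
      have h1 := hA w hw
      rw [hwp] at h1
      exact hYT 0 w hw (h1.unique hε (hε1 y hy) ▸ hy)
    · obtain ⟨w, hw, hwp⟩ := Finset.mem_image.1 h
      have h1 := hB w hw
      rw [hwp] at h1
      exact hYT 1 w hw (h1.unique hε (hε1 y hy) ▸ hy)
  have hsub : T.image P ∪
      (W.image (fun w => w + m (Y 0 w)) ∪ W.image (fun w => M (Y 1 w) + w)) ⊆ W + W := by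
    refine Finset.union_subset (Finset.image_subset_iff.2 fun y hy => (hP y hy).1)
      (Finset.union_subset (Finset.image_subset_iff.2 fun w hw => ?_)
        (Finset.image_subset_iff.2 fun w hw => ?_))
    · exact Finset.add_mem_add hw (hmW _)
    · exact Finset.add_mem_add (hMW _) hw
  have h1 := Finset.card_le_card hsub
  rw [Finset.card_union_of_disjoint hdisj, Finset.card_image_of_injOn hinjT] at h1
  have h2 := Finset.card_union_add_card_inter (W.image (fun w => w + m (Y 0 w)))
    (W.image (fun w => M (Y 1 w) + w))
  rw [Finset.card_image_of_injOn hinjA, Finset.card_image_of_injOn hinjB] at h2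
  have h3 := Finset.card_le_card hAB
  rw [Finset.card_singleton] at h3
  omega

/-- for a tropical system of two tropical polynomials in `ℝ²` with the
same support `W`, the set of nondegenerate solutions is finite and twice its
cardinality is at most `(|W| − 1)(|W| − 2)`. -/
theorem trop_same_support_bound (W : Finset (Fin 2 → ℝ)) (hW : W.Nonempty)
    (a : Fin 2 → (Fin 2 → ℝ) → ℝ) :
    {x : Fin 2 → ℝ | IsNondegTropSol₂ W hW a x}.Finite ∧
    2 * ({x : Fin 2 → ℝ | IsNondegTropSol₂ W hW a x}.ncard : ℤ)
      ≤ ((W.card : ℤ) - 1) * ((W.card : ℤ) - 2) := by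
  have hT : ∀ T : Finset (Fin 2 → ℝ), (∀ y ∈ T, IsNondegTropSol₂ W hW a y) →
      2 * (T.card : ℤ) ≤ ((W.card : ℤ) - 1) * ((W.card : ℤ) - 2) := by
    intro T hT
    have h1 := card_add_two_mul_card_le W hW a T hT
    have h2 := two_mul_card_add_self_le W
    zify at h1 h2
    linarith
  have hfin : {x : Fin 2 → ℝ | IsNondegTropSol₂ W hW a x}.Finite := by
    by_contra hinf
    obtain ⟨T, hTS, hTc⟩ := Set.Infinite.exists_subset_card_eq hinf (W.card * W.card + 1)
    have h1 := hT T fun y hy => hTS hy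
    rw [hTc] at h1
    push_cast at h1
    have h2 : (0 : ℤ) < W.card := by exact_mod_cast hW.card_pos
    nlinarith
  refine ⟨hfin, ?_⟩
  rw [Set.ncard_eq_toFinset_card _ hfin]
  exact hT _ fun y hy => by simpa using hy
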